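/- Let C, b > 0 and let w : ℝ → ℂ be a continuous function with |w(x)| ≤ C·e^{−b|x|} for all x ∈ ℝ. Suppose that for every polynomial S ∈ ℂ[X] the integral ∫_ℝ S(x)·conj(S(x))·w(x) dx is a nonnegative real number. Then w(x) is a nonnegative real number for every x ∈ ℝ. -/

import Mathlib

open MeasureTheory ProbabilityTheory Filter Topology

/-- Two finite measures on `ℝ` with exponential moments and the same moments are equal. -/
theorem measure_ext_of_moments {μ ν : Measure ℝ} [IsFiniteMeasure μ] [IsFiniteMeasure ν]
    (hμ : 0 ∈ interior (integrableExpSet id μ)) (hν : 0 ∈ interior (integrableExpSet id ν))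
    (h : ∀ n : ℕ, ∫ x, x ^ n ∂μ = ∫ x, x ^ n ∂ν) : μ = ν := by
  set U : Set ℂ := Complex.reLm ⁻¹'
    (interior (integrableExpSet id μ) ∩ interior (integrableExpSet id ν)) with hU
  have hUconv : Convex ℝ U :=
    (convex_integrableExpSet.interior.inter convex_integrableExpSet.interior).linear_preimage _
  have hmem : ∀ z : ℂ, z.re = 0 → z ∈ U := fun z hz => by
    simp only [hU, Set.mem_preimage, Complex.reLm_coe, hz]
    exact ⟨hμ, hν⟩
  have han : AnalyticOnNhd ℂ (complexMGF id μ - complexMGF id ν) U := fun z hz =>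
    (analyticAt_complexMGF hz.1).sub (analyticAt_complexMGF hz.2)
  have hzero : ∀ᶠ z in 𝓝 (0 : ℂ), (complexMGF id μ - complexMGF id ν) z = 0 := by
    have h0 := han 0 (hmem 0 rfl)
    rw [← analyticOrderAt_eq_top, ENat.eq_top_iff_forall_ge]
    intro n
    rw [natCast_le_analyticOrderAt_iff_iteratedDeriv_eq_zero h0]
    intro i _
    rw [iteratedDeriv_sub (analyticAt_complexMGF (by simpa using hμ)).contDiffAt
      (analyticAt_complexMGF (by simpa using hν)).contDiffAt,
      iteratedDeriv_complexMGF (by simpa using hμ), iteratedDeriv_complexMGF (by simpa using hν),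
      sub_eq_zero]
    simp only [zero_mul, Complex.exp_zero, mul_one, id_eq]
    exact_mod_cast congrArg (fun r : ℝ => (r : ℂ)) (h i)
  have heq := han.eqOn_zero_of_preconnected_of_eventuallyEq_zero hUconv.isPreconnected
    (hmem 0 rfl) hzero
  refine Measure.ext_of_charFun (funext fun t => ?_)
  rw [← complexMGF_id_mul_I, ← complexMGF_id_mul_I]
  exact sub_eq_zero.1 (heq (hmem (t * Complex.I) (by simp)))

theorem zero_mem_interior_integrableExpSet {μ : Measure ℝ} {c : ℝ} (hc : 0 < c)
    (h : Integrable (fun x => Real.exp (c * |x|)) μ) : 0 ∈ interior (integrableExpSet id μ) := by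
  rw [mem_interior_iff_mem_nhds]
  filter_upwards [Metric.ball_mem_nhds (0 : ℝ) hc] with t ht
  rw [Metric.mem_ball, dist_zero_right, Real.norm_eq_abs] at ht
  refine h.mono' (by fun_prop) (ae_of_all _ fun x => ?_)
  rw [Real.norm_eq_abs, Real.abs_exp, Real.exp_le_exp]
  calc t * x ≤ |t * x| := le_abs_self _
    _ = |t| * |x| := abs_mul _ _
    _ ≤ c * |x| := by gcongr

theorem integrable_mul_polynomial_eval {μ : Measure ℝ} {c : ℝ} (hc : 0 < c) {g : ℝ → ℝ}
    (hg : AEStronglyMeasurable g μ) (hexp : Integrable (fun x => g x * Real.exp (c * |x|)) μ)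
    (P : Polynomial ℝ) : Integrable (fun x => g x * P.eval x) μ := by
  induction P using Polynomial.induction_on' with
  | add p q hp hq => simpa only [Polynomial.eval_add, mul_add] using hp.fun_add hq
  | monomial n a =>
    suffices Integrable (fun x => g x * x ^ n) μ by
      simpa [mul_left_comm] using this.const_mul a
    have hbd : Integrable (fun x => (Nat.factorial n / c ^ n) * ‖g x * Real.exp (c * |x|)‖) μ :=
      hexp.norm.const_mul _
    refine hbd.mono' (hg.mul (by fun_prop)) (ae_of_all _ fun x => ?_)
    have h1 := Real.pow_div_factorial_le_exp (c * |x|) (by positivity) n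
    rw [div_le_iff₀ (by positivity), mul_pow] at h1
    rw [norm_mul, norm_mul, norm_pow, Real.norm_eq_abs x, Real.norm_eq_abs (Real.exp _),
      Real.abs_exp, div_mul_eq_mul_div, le_div_iff₀ (by positivity)]
    nlinarith [mul_le_mul_of_nonneg_left h1 (norm_nonneg (g x))]

theorem ae_eq_zero_of_moments_eq_zero {μ : Measure ℝ} [IsFiniteMeasure μ] {c : ℝ} (hc : 0 < c)
    {g : ℝ → ℝ} (hg : Integrable g μ)
    (hexp : Integrable (fun x => g x * Real.exp (c * |x|)) μ)
    (hmom : ∀ n : ℕ, ∫ x, g x * x ^ n ∂μ = 0) : g =ᵐ[μ] 0 := by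
  have hint : ∀ n : ℕ, Integrable (fun x => g x * x ^ n) μ := fun n => by
    simpa using integrable_mul_polynomial_eval hc hg.1 hexp (Polynomial.X ^ n)
  have hfin : ∀ f : ℝ → ℝ, Integrable f μ →
      IsFiniteMeasure (μ.withDensity fun x => ENNReal.ofReal (f x)) :=
    fun f hf => isFiniteMeasure_withDensity_ofReal hf.2
  have hset : ∀ f : ℝ → ℝ, Integrable f μ →
      Integrable (fun x => f x * Real.exp (c * |x|)) μ →
      0 ∈ interior (integrableExpSet id (μ.withDensity fun x => ENNReal.ofReal (f x))) := by
    intro f hf hfe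
    refine zero_mem_interior_integrableExpSet hc ?_
    rw [integrable_withDensity_iff_integrable_smul₀' hf.1.aemeasurable.ennreal_ofReal
      (ae_of_all _ fun _ => ENNReal.ofReal_lt_top)]
    refine hfe.norm.mono' (by
      have := hf.1.aemeasurable
      exact (AEMeasurable.aestronglyMeasurable (by fun_prop))) (ae_of_all _ fun x => ?_)
    rw [smul_eq_mul, ENNReal.toReal_ofReal', norm_mul, norm_mul]
    gcongr
    rw [Real.norm_eq_abs, Real.norm_eq_abs, abs_of_nonneg (le_max_right _ _)]
    exact max_le (le_abs_self _) (abs_nonneg _)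
  have hval : ∀ f : ℝ → ℝ, Integrable f μ → ∀ n : ℕ,
      ∫ x, x ^ n ∂(μ.withDensity fun x => ENNReal.ofReal (f x)) = ∫ x, max (f x) 0 * x ^ n ∂μ := by
    intro f hf n
    rw [integral_withDensity_eq_integral_toReal_smul₀ hf.1.aemeasurable.ennreal_ofReal
      (ae_of_all _ fun _ => ENNReal.ofReal_lt_top)]
    simp only [smul_eq_mul, ENNReal.toReal_ofReal']
  have hmax : ∀ f : ℝ → ℝ, AEStronglyMeasurable f μ → ∀ n : ℕ,
      Integrable (fun x => f x * x ^ n) μ → Integrable (fun x => max (f x) 0 * x ^ n) μ := by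
    intro f hf n hfn
    refine hfn.norm.mono' ((hf.sup aestronglyMeasurable_const).mul (by fun_prop))
      (ae_of_all _ fun x => ?_)
    rw [norm_mul, norm_mul]
    gcongr
    rw [Real.norm_eq_abs, Real.norm_eq_abs, abs_of_nonneg (le_max_right _ _)]
    exact max_le (le_abs_self _) (abs_nonneg _)
  have hgn : Integrable (fun x => -g x) μ := hg.neg
  have := hfin g hg
  have := hfin (fun x => -g x) hgn
  have heq := measure_ext_of_moments (hset g hg hexp)
    (hset (fun x => -g x) hgn (by simpa only [neg_mul] using hexp.fun_neg)) (fun n => by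
      rw [hval g hg, hval _ hgn, ← sub_eq_zero, ← integral_sub (hmax g hg.1 n (hint n))
        (hmax _ hgn.1 n (by simpa only [neg_mul] using (hint n).fun_neg))]
      refine (integral_congr_ae (ae_of_all _ fun x => ?_)).trans (hmom n)
      simp only [← sub_mul]
      rw [max_zero_sub_max_neg_zero_eq_self])
  rw [withDensity_eq_iff hg.1.aemeasurable.ennreal_ofReal hgn.1.aemeasurable.ennreal_ofReal
    hg.lintegral_lt_top.ne] at heq
  filter_upwards [heq] with x hx
  have hx' := congrArg ENNReal.toReal hx
  simp only [ENNReal.toReal_ofReal'] at hx'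
  have := max_zero_sub_max_neg_zero_eq_self (g x)
  simp only [Pi.zero_apply]
  grind

theorem integrable_polynomial_eval {μ : Measure ℝ}
    (hμ : 0 ∈ interior (integrableExpSet id μ)) (P : Polynomial ℝ) :
    Integrable (fun x => P.eval x) μ := by
  induction P using Polynomial.induction_on' with
  | add p q hp hq => simpa only [Polynomial.eval_add] using hp.fun_add hq
  | monomial n a =>
    simpa using (integrable_pow_of_mem_interior_integrableExpSet hμ n).const_mul a

theorem memLp_two_polynomial_eval {μ : Measure ℝ}
    (hμ : 0 ∈ interior (integrableExpSet id μ)) (P : Polynomial ℝ) :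
    MemLp (fun x => P.eval x) 2 μ := by
  rw [memLp_two_iff_integrable_sq (integrable_polynomial_eval hμ P).1]
  exact (integrable_polynomial_eval hμ (P ^ 2)).congr
    (ae_of_all _ fun x => Polynomial.eval_pow 2)

/-- Polynomials are dense in `L²(μ)` when `μ` has an exponential moment. -/
theorem exists_polynomial_integral_sub_sq_lt {μ : Measure ℝ} [IsFiniteMeasure μ] {c : ℝ}
    (hc : 0 < c) (hμ : Integrable (fun x => Real.exp (c * |x|)) μ)
    {f : ℝ → ℝ} (hf : MemLp f 2 μ) {ε : ℝ} (hε : 0 < ε) :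
    ∃ P : Polynomial ℝ, ∫ x, (f x - P.eval x) ^ 2 ∂μ < ε := by
  have h0 := zero_mem_interior_integrableExpSet hc hμ
  let φ : Polynomial ℝ →ₗ[ℝ] Lp ℝ 2 μ :=
    { toFun := fun P => (memLp_two_polynomial_eval h0 P).toLp
      map_add' := fun P Q => by
        rw [← MemLp.toLp_add]
        exact MemLp.toLp_congr _ _ (ae_of_all _ fun x => by simp)
      map_smul' := fun a P => by
        rw [RingHom.id_apply, ← MemLp.toLp_const_smul]
        exact MemLp.toLp_congr _ _ (ae_of_all _ fun x => by simp) }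
  have hdense : (LinearMap.range φ).topologicalClosure = ⊤ := by
    rw [Submodule.topologicalClosure_eq_top_iff, Submodule.eq_bot_iff]
    intro g hg
    rw [Submodule.mem_orthogonal'] at hg
    have hg2 := Lp.memLp g
    have hexp : MemLp (fun x => Real.exp (c / 2 * |x|)) 2 μ := by
      rw [memLp_two_iff_integrable_sq (by fun_prop)]
      refine hμ.congr (ae_of_all _ fun x => ?_)
      simp only [← Real.exp_nat_mul]
      congr 1
      push_cast
      ring
    refine (Lp.eq_zero_iff_ae_eq_zero).2 (ae_eq_zero_of_moments_eq_zero (half_pos hc)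
      (hg2.integrable one_le_two) (hg2.integrable_mul hexp) fun n => ?_)
    have := hg (φ (Polynomial.X ^ n)) ⟨_, rfl⟩
    rw [L2.inner_def] at this
    rw [← this]
    refine integral_congr_ae ?_
    filter_upwards [(memLp_two_polynomial_eval h0 (Polynomial.X ^ n)).coeFn_toLp] with x hx
    simp only [φ, LinearMap.coe_mk, AddHom.coe_mk, hx]
    simp [mul_comm]
  have hmem : hf.toLp ∈ closure (Set.range φ) := by
    have : hf.toLp ∈ (LinearMap.range φ).topologicalClosure := hdense ▸ Submodule.mem_top
    exact this
  obtain ⟨_, ⟨P, rfl⟩, hP⟩ := Metric.mem_closure_iff.1 hmem (√ε) (by positivity)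
  refine ⟨P, ?_⟩
  rw [dist_eq_norm, Real.lt_sqrt (norm_nonneg _), ← real_inner_self_eq_norm_sq, L2.inner_def] at hP
  refine lt_of_eq_of_lt (integral_congr_ae ?_) hP
  filter_upwards [hf.coeFn_toLp, (memLp_two_polynomial_eval h0 P).coeFn_toLp,
    Lp.coeFn_sub hf.toLp (φ P)] with x h1 h2 h3
  have h4 : (φ P) x = P.eval x := h2
  rw [h3, Pi.sub_apply, h1, h4, real_inner_self_eq_norm_sq, Real.norm_eq_abs, sq_abs]

/-- A bounded density that is nonnegative against all squares of polynomials is nonnegative. -/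
theorem ae_nonneg_of_integral_sq_mul_nonneg {μ : Measure ℝ} [IsFiniteMeasure μ] {c : ℝ}
    (hc : 0 < c) (hμ : Integrable (fun x => Real.exp (c * |x|)) μ)
    {h : ℝ → ℝ} (hh : Measurable h) {C : ℝ} (hC : 0 < C) (hbd : ∀ x, |h x| ≤ C)
    (hpos : ∀ P : Polynomial ℝ, 0 ≤ ∫ x, P.eval x ^ 2 * h x ∂μ) : 0 ≤ᵐ[μ] h := by
  have h0 := zero_mem_interior_integrableExpSet hc hμ
  have hs : MeasurableSet {x | h x < 0} := measurableSet_lt hh measurable_const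
  set f : ℝ → ℝ := {x | h x < 0}.indicator 1 with hf
  have hfval : ∀ x, f x ^ 2 * h x = min (h x) 0 := fun x => by
    by_cases hx : h x < 0
    · simp [hf, hx, hx.le]
    · simp [hf, hx, not_lt.1 hx]
  have hfmem : MemLp f 2 μ := memLp_indicator_const 2 hs (1 : ℝ) (Or.inr (measure_ne_top _ _))
  have hfint : Integrable (fun x => f x ^ 2) μ := hfmem.integrable_sq
  have hmul : ∀ {k : ℝ → ℝ}, Integrable k μ → Integrable (fun x => k x * h x) μ := fun hk =>
    hk.mul_bdd hh.aestronglyMeasurable (ae_of_all _ hbd)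
  set I := ∫ x, f x ^ 2 ∂μ with hI
  have hI0 : 0 ≤ I := integral_nonneg fun x => sq_nonneg _
  have hmin : Integrable (fun x => min (h x) 0) μ := by
    simpa only [hfval] using hmul hfint
  have hkey : 0 ≤ ∫ x, min (h x) 0 ∂μ := by
    by_contra! hneg
    set J := ∫ x, min (h x) 0 ∂μ with hJ
    obtain ⟨δ, hδ, hδJ⟩ : ∃ δ : ℝ, 0 < δ ∧ C * (δ * I) < -J / 2 := by
      refine ⟨-J / (2 * C * (I + 1)) / 2, by
        have := neg_pos.2 hneg
        positivity, ?_⟩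
      have hJ' := neg_pos.2 hneg
      have : C * (-J / (2 * C * (I + 1)) / 2 * I) = -J / 4 * (I / (I + 1)) := by
        field_simp
        ring
      rw [this]
      have : I / (I + 1) ≤ 1 := (div_le_one (by positivity)).2 (by linarith)
      nlinarith
    obtain ⟨P, hP⟩ := exists_polynomial_integral_sub_sq_lt hc hμ hfmem
      (ε := -J / 2 / (C * (1 + δ⁻¹))) (by have := neg_pos.2 hneg; positivity)
    have hsub : Integrable (fun x => (f x - P.eval x) ^ 2) μ :=
      (hfmem.sub (memLp_two_polynomial_eval h0 P)).integrable_sq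
    have hPint : Integrable (fun x => P.eval x ^ 2) μ :=
      (memLp_two_polynomial_eval h0 P).integrable_sq
    have hle : ∫ x, P.eval x ^ 2 * h x ∂μ ≤
        ∫ x, (min (h x) 0 + C * (δ * f x ^ 2 + (1 + δ⁻¹) * (f x - P.eval x) ^ 2)) ∂μ := by
      refine integral_mono (hmul hPint)
        (hmin.fun_add (((hfint.const_mul δ).fun_add (hsub.const_mul _)).const_mul C)) fun x => ?_
      simp only [← hfval x]
      generalize P.eval x = p
      generalize f x = q
      have hab : |p ^ 2 - q ^ 2| ≤ δ * q ^ 2 + (1 + δ⁻¹) * (q - p) ^ 2 := by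
        have e1 : 0 ≤ δ⁻¹ * (δ * q - (q - p)) ^ 2 := by positivity
        have e2 : 0 ≤ δ⁻¹ * (δ * q + (q - p)) ^ 2 := by positivity
        have e1' : δ⁻¹ * (δ * q - (q - p)) ^ 2 =
            δ * q ^ 2 - 2 * q * (q - p) + δ⁻¹ * (q - p) ^ 2 := by field_simp; ring
        have e2' : δ⁻¹ * (δ * q + (q - p)) ^ 2 =
            δ * q ^ 2 + 2 * q * (q - p) + δ⁻¹ * (q - p) ^ 2 := by field_simp; ring
        rw [abs_le]
        constructor <;> nlinarith [sq_nonneg (q - p)]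
      have : (p ^ 2 - q ^ 2) * h x ≤ C * (δ * q ^ 2 + (1 + δ⁻¹) * (q - p) ^ 2) :=
        calc (p ^ 2 - q ^ 2) * h x ≤ |p ^ 2 - q ^ 2| * |h x| :=
              (le_abs_self _).trans (abs_mul _ _).le
          _ ≤ (δ * q ^ 2 + (1 + δ⁻¹) * (q - p) ^ 2) * C := by
              have := hbd x
              gcongr
          _ = _ := mul_comm _ _
      linarith
    rw [integral_add hmin (((hfint.const_mul δ).fun_add (hsub.const_mul _)).const_mul C),
      integral_const_mul, integral_add (hfint.const_mul δ) (hsub.const_mul _),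
      integral_const_mul, integral_const_mul, ← hI, ← hJ] at hle
    rw [lt_div_iff₀ (by positivity)] at hP
    have := hpos P
    nlinarith
  have hz : (fun x => -min (h x) 0) =ᵐ[μ] 0 := by
    rw [← integral_eq_zero_iff_of_nonneg (fun x => neg_nonneg.2 (min_le_right _ _)) hmin.fun_neg,
      integral_neg, neg_eq_zero]
    exact le_antisymm (integral_nonpos fun x => min_le_right _ _) hkey
  filter_upwards [hz] with x hx
  simpa using hx

theorem integrable_exp_neg_mul_abs {b : ℝ} (hb : 0 < b) :
    Integrable fun x : ℝ => Real.exp (-b * |x|) := by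
  rw [← integrableOn_univ, ← Set.Iic_union_Ioi (a := (0 : ℝ)), integrableOn_union]
  refine ⟨(integrableOn_exp_mul_Iic hb 0).congr_fun (fun x hx => ?_) measurableSet_Iic,
    (integrableOn_exp_mul_Ioi (neg_neg_of_pos hb) 0).congr_fun (fun x hx => ?_) measurableSet_Ioi⟩
  · simp [abs_of_nonpos (Set.mem_Iic.1 hx)]
  · simp [abs_of_pos (Set.mem_Ioi.1 hx)]

theorem real_weight_nonneg_of_integrals_nonneg {C b : ℝ} (hC : 0 < C) (hb : 0 < b)
    {u : ℝ → ℝ} (hu : Continuous u) (hbound : ∀ x, |u x| ≤ C * Real.exp (-b * |x|))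
    (hpos : ∀ P : Polynomial ℝ, 0 ≤ ∫ x, P.eval x ^ 2 * u x) (x : ℝ) : 0 ≤ u x := by
  have hmeas : Measurable fun x : ℝ => ENNReal.ofReal (Real.exp (-b * |x|)) := by fun_prop
  have hlt : ∀ᵐ x : ℝ, ENNReal.ofReal (Real.exp (-b * |x|)) < ⊤ :=
    ae_of_all _ fun _ => ENNReal.ofReal_lt_top
  set μ : Measure ℝ := volume.withDensity fun x => ENNReal.ofReal (Real.exp (-b * |x|)) with hμ
  have : IsFiniteMeasure μ :=
    isFiniteMeasure_withDensity_ofReal (integrable_exp_neg_mul_abs hb).2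
  have hac : volume ≪ μ := withDensity_absolutelyContinuous' hmeas.aemeasurable
    (ae_of_all _ fun x => by simp [Real.exp_pos])
  have hcancel : ∀ x, Real.exp (-b * |x|) * Real.exp (b * |x|) = 1 := fun x => by
    rw [← Real.exp_add]
    simp
  have hexp : Integrable (fun x => Real.exp (b / 2 * |x|)) μ := by
    rw [hμ, integrable_withDensity_iff_integrable_smul' hmeas hlt]
    refine (integrable_exp_neg_mul_abs (half_pos hb)).congr (ae_of_all _ fun x => ?_)
    simp only [ENNReal.toReal_ofReal (Real.exp_pos _).le, smul_eq_mul, ← Real.exp_add]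
    congr 1
    ring
  have hae : ∀ᵐ x, 0 ≤ u x := by
    have := hac.ae_le (ae_nonneg_of_integral_sq_mul_nonneg (half_pos hb) hexp
      (h := fun x => u x * Real.exp (b * |x|)) (by fun_prop) hC (fun x => by
        rw [abs_mul, Real.abs_exp]
        calc |u x| * Real.exp (b * |x|)
            ≤ C * Real.exp (-b * |x|) * Real.exp (b * |x|) := by gcongr; exact hbound x
          _ = C := by rw [mul_assoc, hcancel, mul_one]) fun P => by
        rw [hμ, integral_withDensity_eq_integral_toReal_smul hmeas hlt]
        refine (hpos P).trans_eq (integral_congr_ae (ae_of_all _ fun x => ?_))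
        simp only [ENNReal.toReal_ofReal (Real.exp_pos _).le, smul_eq_mul]
        linear_combination (-(P.eval x ^ 2 * u x)) * hcancel x)
    filter_upwards [this] with x hx
    exact nonneg_of_mul_nonneg_left hx (Real.exp_pos _)
  have hmin : (fun x => min (u x) 0) = fun _ => 0 :=
    Continuous.ae_eq_iff_eq volume (hu.min continuous_const) continuous_const |>.1
      (hae.mono fun x hx => min_eq_right hx)
  exact min_eq_right_iff.1 (congrFun hmin x)

/-- Let `w : ℝ → ℂ` be continuous with `|w(x)| ≤ C·exp(−b|x|)`. If for every polynomial
`S ∈ ℂ[X]` the integral `∫ S(x)·conj(S(x))·w(x) dx` is a nonnegative real number, then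
`w(x)` is a nonnegative real number for every `x`. -/
theorem weight_nonneg_of_integrals_nonneg
    (C b : ℝ) (hC : 0 < C) (hb : 0 < b)
    (w : ℝ → ℂ) (hw : Continuous w)
    (hbound : ∀ x : ℝ, ‖w x‖ ≤ C * Real.exp (-b * |x|))
    (hpos : ∀ S : Polynomial ℂ, ∃ ρ : ℝ, 0 ≤ ρ ∧
      (∫ x : ℝ, S.eval (x : ℂ) * (starRingEnd ℂ) (S.eval (x : ℂ)) * w x) = (ρ : ℂ)) :
    ∀ x : ℝ, ∃ ρ : ℝ, 0 ≤ ρ ∧ w x = (ρ : ℂ) := by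
  have hint : ∀ P : Polynomial ℝ, Integrable fun x : ℝ => ((P.eval x ^ 2 : ℝ) : ℂ) * w x := by
    intro P
    have hexp := integrable_mul_polynomial_eval (μ := volume) (half_pos hb)
      (g := fun x => Real.exp (-b * |x|)) (by fun_prop)
      ((integrable_exp_neg_mul_abs (half_pos hb)).congr (ae_of_all _ fun x => by
        simp only [← Real.exp_add]
        congr 1
        ring)) (P ^ 2)
    refine (hexp.const_mul C).mono' (by fun_prop) (ae_of_all _ fun x => ?_)
    rw [norm_mul, Complex.norm_real, Real.norm_eq_abs, abs_of_nonneg (sq_nonneg _),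
      Polynomial.eval_pow]
    nlinarith [mul_le_mul_of_nonneg_left (hbound x) (sq_nonneg (P.eval x))]
  have hval : ∀ P : Polynomial ℝ, 0 ≤ ∫ x, P.eval x ^ 2 * (w x).re ∧
      ∫ x, P.eval x ^ 2 * (w x).im = 0 := by
    intro P
    obtain ⟨ρ, hρ, h⟩ := hpos (P.map (algebraMap ℝ ℂ))
    have heq : ∀ x : ℝ, (P.map (algebraMap ℝ ℂ)).eval (x : ℂ) = ((P.eval x : ℝ) : ℂ) := fun x =>
      (Polynomial.eval_map_algebraMap P (x : ℂ)).trans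
        (Polynomial.aeval_algebraMap_apply_eq_algebraMap_eval x P)
    have h' : ∫ x : ℝ, ((P.eval x ^ 2 : ℝ) : ℂ) * w x = ρ := by
      rw [← h]
      refine integral_congr_ae (ae_of_all _ fun x => ?_)
      simp only [heq, Complex.conj_ofReal]
      push_cast
      ring
    have hre := integral_re (hint P)
    have him := integral_im (hint P)
    rw [h'] at hre him
    simp only [RCLike.re_to_complex, RCLike.im_to_complex, Complex.re_ofReal_mul,
      Complex.im_ofReal_mul, Complex.ofReal_re, Complex.ofReal_im] at hre him
    exact ⟨hre ▸ hρ, him⟩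
  intro x
  have hre := real_weight_nonneg_of_integrals_nonneg hC hb (Complex.continuous_re.comp hw)
    (fun x => (Complex.abs_re_le_norm _).trans (hbound x)) (fun P => (hval P).1) x
  have him := real_weight_nonneg_of_integrals_nonneg hC hb (Complex.continuous_im.comp hw)
    (fun x => (Complex.abs_im_le_norm _).trans (hbound x)) (fun P => (hval P).2.ge) x
  have him' := real_weight_nonneg_of_integrals_nonneg hC hb (Complex.continuous_im.comp hw).neg
    (fun x => (abs_neg _).trans_le ((Complex.abs_im_le_norm _).trans (hbound x)))
    (fun P => by
      have := (hval P).2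
      simp [integral_neg, this]) x
  exact ⟨(w x).re, hre, Complex.ext rfl (by
    simpa using le_antisymm (neg_nonneg.1 him') him)⟩
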